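/- arXiv:1812.07766 — 3 statements merged into one kernel-verified Lean document; each statement's English description precedes it below -/
import Mathlib

section
/- Consider a B₀ T²-symmetric Einstein flow with initial data given at time τ = s₀, and set ρ₀ := min_{θ ∈ S¹} ρ(θ, s₀). Then for all τ ≥ s₀, | ⟨V_τ⟩ ⟨(1/2) e^{ρ−2τ} V_τ⟩ | ≲ e^{−ρ₀/2} e^{−τ} ( |A| + e^{τ} e^{2(ΠE)^{1/2}} Π E ) E^{1/2}. -/
noncomputable section

open Real MeasureTheory intervalIntegral

/-- The θ-mean of a function on the circle of circumference 1 (total measure 1). -/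
def circleMean (f : ℝ → ℝ) : ℝ := ∫ θ in (0:ℝ)..1, f θ

/-- The smooth, θ-periodic fields `V, Q, ρ, l` of a T²-symmetric spacetime in areal
coordinates; first argument is `τ`, second is `θ`. -/
structure T2Flow where
  V : ℝ → ℝ → ℝ
  Q : ℝ → ℝ → ℝ
  ρ : ℝ → ℝ → ℝ
  l : ℝ → ℝ → ℝ
  smooth_V : ContDiff ℝ (⊤ : ℕ∞) (Function.uncurry V)
  smooth_Q : ContDiff ℝ (⊤ : ℕ∞) (Function.uncurry Q)
  smooth_ρ : ContDiff ℝ (⊤ : ℕ∞) (Function.uncurry ρ)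
  smooth_l : ContDiff ℝ (⊤ : ℕ∞) (Function.uncurry l)
  periodic_V : ∀ τ, Function.Periodic (V τ) 1
  periodic_Q : ∀ τ, Function.Periodic (Q τ) 1
  periodic_ρ : ∀ τ, Function.Periodic (ρ τ) 1
  periodic_l : ∀ τ, Function.Periodic (l τ) 1

namespace T2Flow

/-- `V_τ`. -/
def Vτ (F : T2Flow) (τ θ : ℝ) : ℝ := deriv (fun s => F.V s θ) τ
/-- `V_θ`. -/
def Vθ (F : T2Flow) (τ θ : ℝ) : ℝ := deriv (fun x => F.V τ x) θ
/-- `Q_τ`. -/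
def Qτ (F : T2Flow) (τ θ : ℝ) : ℝ := deriv (fun s => F.Q s θ) τ
/-- `Q_θ`. -/
def Qθ (F : T2Flow) (τ θ : ℝ) : ℝ := deriv (fun x => F.Q τ x) θ
/-- `ρ_τ`. -/
def ρτ (F : T2Flow) (τ θ : ℝ) : ℝ := deriv (fun s => F.ρ s θ) τ
/-- `l_τ`. -/
def lτ (F : T2Flow) (τ θ : ℝ) : ℝ := deriv (fun s => F.l s θ) τ
/-- `l_θ`. -/
def lθ (F : T2Flow) (τ θ : ℝ) : ℝ := deriv (fun x => F.l τ x) θ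

/-- The energy density
`J = (1/2)[V_τ² + e^{2(τ−ρ)}V_θ² + e^{2(V−τ)}(Q_τ² + e^{2(τ−ρ)}Q_θ²)]`. -/
def J (F : T2Flow) (τ θ : ℝ) : ℝ :=
  (1/2) * (F.Vτ τ θ ^ 2 + exp (2*(τ - F.ρ τ θ)) * F.Vθ τ θ ^ 2
    + exp (2*(F.V τ θ - τ)) * (F.Qτ τ θ ^ 2 + exp (2*(τ - F.ρ τ θ)) * F.Qθ τ θ ^ 2))

/-- The T²-symmetric vacuum Einstein evolution equations together with the
momentum constraint. -/
def IsEinsteinFlow (F : T2Flow) : Prop :=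
  (∀ τ θ : ℝ, deriv (fun s => exp (F.ρ s θ) * F.Vτ s θ) τ
      = deriv (fun x => exp (2*τ - F.ρ τ x) * F.Vθ τ x) θ
        + exp (2*(F.V τ θ - τ) + F.ρ τ θ)
          * (F.Qτ τ θ ^ 2 - exp (2*(τ - F.ρ τ θ)) * F.Qθ τ θ ^ 2)) ∧
  (∀ τ θ : ℝ, deriv (fun s => exp (F.ρ s θ + 2*(F.V s θ - s)) * F.Qτ s θ) τ
      = deriv (fun x => exp (-F.ρ τ x + 2*F.V τ x) * F.Qθ τ x) θ) ∧
  (∀ τ θ : ℝ, F.lτ τ θ + F.ρτ τ θ + 2 = F.J τ θ) ∧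
  (∀ τ θ : ℝ, F.ρτ τ θ = exp (F.l τ θ)) ∧
  (∀ τ θ : ℝ, F.lθ τ θ = F.Vθ τ θ * F.Vτ τ θ
      + exp (2*(F.V τ θ - τ)) * F.Qθ τ θ * F.Qτ τ θ)

/-- The conserved quantity `A = ∫ e^ρ (V_τ − e^{2(V−τ)} Q_τ Q) dθ`. -/
def A (F : T2Flow) (τ : ℝ) : ℝ :=
  ∫ θ in (0:ℝ)..1,
    exp (F.ρ τ θ) * (F.Vτ τ θ - exp (2*(F.V τ θ - τ)) * F.Qτ τ θ * F.Q τ θ)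

/-- The conserved quantity `B = ∫ e^{ρ+2(V−τ)} Q_τ dθ`. -/
def B (F : T2Flow) (τ : ℝ) : ℝ :=
  ∫ θ in (0:ℝ)..1, exp (F.ρ τ θ + 2*(F.V τ θ - τ)) * F.Qτ τ θ

/-- The energy `E = ∫ e^{ρ−2τ} J dθ`. -/
def E (F : T2Flow) (τ : ℝ) : ℝ := ∫ θ in (0:ℝ)..1, exp (F.ρ τ θ - 2*τ) * F.J τ θ

/-- The `S¹`-volume `Π = ⟨e^ρ⟩`. -/
def Pi (F : T2Flow) (τ : ℝ) : ℝ := ∫ θ in (0:ℝ)..1, exp (F.ρ τ θ)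

/-- The correction `Λ = (1/2) e^{−2τ} ∫ V_τ (V − ⟨V⟩ − 1) e^ρ dθ`. -/
def Λ (F : T2Flow) (τ : ℝ) : ℝ :=
  (1/2) * exp (-2*τ) *
    ∫ θ in (0:ℝ)..1, F.Vτ τ θ * (F.V τ θ - circleMean (F.V τ) - 1) * exp (F.ρ τ θ)

/-- The corrected, normalized energy `H = Π (E + Λ)`. -/
def H (F : T2Flow) (τ : ℝ) : ℝ := F.Pi τ * (F.E τ + F.Λ τ)

/-- The twist potential `Y = ⟨e^{l+ρ+2τ}⟩`. -/
def Y (F : T2Flow) (τ : ℝ) : ℝ := ∫ θ in (0:ℝ)..1, exp (F.l τ θ + F.ρ τ θ + 2*τ)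

/-- The error term `Ω = ⟨e^{l+ρ+2τ} J⟩ − e^{2τ} E Y Π⁻¹`. -/
def Ω (F : T2Flow) (τ : ℝ) : ℝ :=
  (∫ θ in (0:ℝ)..1, exp (F.l τ θ + F.ρ τ θ + 2*τ) * F.J τ θ)
    - exp (2*τ) * F.E τ * F.Y τ / F.Pi τ

end T2Flow

/-- Cauchy–Schwarz on `[0, 1]`, in the form `∫ |h| ≤ √(∫ p) √(∫ q)` whenever `h² ≤ p q`. -/
theorem integral_abs_le_sqrt_mul_sqrt {h p q : ℝ → ℝ} {a b : ℝ} (hh : Continuous h)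
    (hp : Continuous p) (hq : Continuous q) (hp0 : ∀ x, 0 ≤ p x) (hq0 : ∀ x, 0 ≤ q x)
    (hpq : ∀ x, h x ^ 2 ≤ p x * q x)
    (ha : ∫ x in (0:ℝ)..1, p x ≤ a) (hb : ∫ x in (0:ℝ)..1, q x ≤ b) :
    ∫ x in (0:ℝ)..1, |h x| ≤ √a * √b := by
  have hcs : Continuous fun x => √(p x) * √(q x) := hp.sqrt.mul hq.sqrt
  set P := ∫ x in (0:ℝ)..1, p x
  set R := ∫ x in (0:ℝ)..1, √(p x) * √(q x)
  set S := ∫ x in (0:ℝ)..1, q x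
  have hquad : ∀ t : ℝ, 0 ≤ S * (t * t) + 2 * R * t + P := by
    intro t
    have heq : ∫ x in (0:ℝ)..1, (√(p x) + t * √(q x)) ^ 2 = S * (t * t) + 2 * R * t + P := by
      have hexp : ∀ x, (√(p x) + t * √(q x)) ^ 2
          = (t * t) * q x + (2 * t) * (√(p x) * √(q x)) + p x := by
        intro x
        linear_combination Real.sq_sqrt (hp0 x) + t ^ 2 * Real.sq_sqrt (hq0 x)
      simp_rw [hexp]
      rw [intervalIntegral.integral_add, intervalIntegral.integral_add,
        intervalIntegral.integral_const_mul, intervalIntegral.integral_const_mul]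
      · simp only [P, R, S]; ring
      all_goals exact Continuous.intervalIntegrable (by fun_prop) _ _
    rw [← heq]
    exact intervalIntegral.integral_nonneg zero_le_one fun x _ => sq_nonneg _
  have hdisc := discrim_le_zero hquad
  have hP : 0 ≤ P := intervalIntegral.integral_nonneg zero_le_one fun x _ => hp0 x
  have hR : R ≤ √P * √S := by
    rw [← Real.sqrt_mul hP]
    apply Real.le_sqrt_of_sq_le
    unfold discrim at hdisc
    linarith
  have hle : ∫ x in (0:ℝ)..1, |h x| ≤ R := by
    refine intervalIntegral.integral_mono_on zero_le_one
      (hh.abs.intervalIntegrable _ _) (hcs.intervalIntegrable _ _) fun x _ => ?_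
    rw [← Real.sqrt_mul (hp0 x)]
    exact Real.abs_le_sqrt (hpq x)
  calc ∫ x in (0:ℝ)..1, |h x| ≤ R := hle
    _ ≤ √P * √S := hR
    _ ≤ √a * √b := by gcongr

theorem abs_sub_le_integral_abs_deriv {f : ℝ → ℝ} (hf : ContDiff ℝ 1 f) {a b : ℝ}
    (ha : a ∈ Set.Icc (0:ℝ) 1) (hb : b ∈ Set.Icc (0:ℝ) 1) :
    |f b - f a| ≤ ∫ x in (0:ℝ)..1, |deriv f x| := by
  have hc : Continuous (deriv f) := hf.continuous_deriv le_rfl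
  rw [← intervalIntegral.integral_deriv_eq_sub'
    f rfl (fun x _ => (hf.differentiable one_ne_zero).differentiableAt) hc.continuousOn]
  refine (intervalIntegral.norm_integral_le_abs_integral_norm (f := deriv f)).trans ?_
  simp only [Real.norm_eq_abs]
  refine intervalIntegral.abs_integral_mono_interval ?_ ?_
    (hc.abs.intervalIntegrable _ _) |>.trans_eq (abs_of_nonneg ?_)
  · rw [Set.uIoc_of_le zero_le_one]
    intro x hx
    rw [Set.mem_uIoc] at hx
    rcases hx with hx | hx
    · exact ⟨ha.1.trans_lt hx.1, hx.2.trans hb.2⟩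
    · exact ⟨hb.1.trans_lt hx.1, hx.2.trans ha.2⟩
  · exact Filter.Eventually.of_forall fun x => abs_nonneg _
  · exact intervalIntegral.integral_nonneg zero_le_one fun x _ => abs_nonneg _

section Uncurry

variable {f : ℝ → ℝ → ℝ}

theorem contDiff_slice_left (hf : ContDiff ℝ (⊤ : ℕ∞) (Function.uncurry f)) (θ : ℝ) :
    ContDiff ℝ 1 fun s => f s θ :=
  have hf1 : ContDiff ℝ 1 (Function.uncurry f) := hf.of_le (mod_cast le_top)
  hf1.comp (contDiff_id.prodMk contDiff_const)

theorem contDiff_slice_right (hf : ContDiff ℝ (⊤ : ℕ∞) (Function.uncurry f)) (τ : ℝ) :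
    ContDiff ℝ 1 (f τ) :=
  have hf1 : ContDiff ℝ 1 (Function.uncurry f) := hf.of_le (mod_cast le_top)
  hf1.comp (contDiff_const.prodMk contDiff_id)

theorem continuous_deriv_slice_left (hf : ContDiff ℝ (⊤ : ℕ∞) (Function.uncurry f)) (τ : ℝ) :
    Continuous fun θ => deriv (fun s => f s θ) τ := by
  have hf1 : ContDiff ℝ 1 (Function.uncurry f) := hf.of_le (mod_cast le_top)
  have heq : (fun θ => deriv (fun s => f s θ) τ)
      = fun θ => fderiv ℝ (Function.uncurry f) (τ, θ) (1, 0) := by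
    funext θ
    have h1 : HasFDerivAt (Function.uncurry f) (fderiv ℝ (Function.uncurry f) (τ, θ)) (τ, θ) :=
      ((hf1.differentiable one_ne_zero) (τ, θ)).hasFDerivAt
    have h2 : HasDerivAt (fun s : ℝ => (s, θ)) ((1 : ℝ), (0 : ℝ)) τ :=
      (hasDerivAt_id τ).prodMk (hasDerivAt_const τ θ)
    exact (h1.comp_hasDerivAt τ h2).deriv
  rw [heq]
  exact ((hf1.continuous_fderiv one_ne_zero).comp (by fun_prop)).clm_apply continuous_const

end Uncurry

namespace T2Flow

variable (F : T2Flow)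

theorem contDiff_V (τ : ℝ) : ContDiff ℝ 1 (F.V τ) := contDiff_slice_right F.smooth_V τ

theorem contDiff_Q (τ : ℝ) : ContDiff ℝ 1 (F.Q τ) := contDiff_slice_right F.smooth_Q τ

theorem continuous_V (τ : ℝ) : Continuous (F.V τ) := (F.contDiff_V τ).continuous

theorem continuous_Q (τ : ℝ) : Continuous (F.Q τ) := (F.contDiff_Q τ).continuous

theorem continuous_ρ (τ : ℝ) : Continuous (F.ρ τ) :=
  (contDiff_slice_right F.smooth_ρ τ).continuous

theorem continuous_Vτ (τ : ℝ) : Continuous (F.Vτ τ) := continuous_deriv_slice_left F.smooth_V τ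

theorem continuous_Qτ (τ : ℝ) : Continuous (F.Qτ τ) := continuous_deriv_slice_left F.smooth_Q τ

theorem continuous_Vθ (τ : ℝ) : Continuous (F.Vθ τ) := (F.contDiff_V τ).continuous_deriv le_rfl

theorem continuous_Qθ (τ : ℝ) : Continuous (F.Qθ τ) := (F.contDiff_Q τ).continuous_deriv le_rfl

theorem continuous_J (τ : ℝ) : Continuous (F.J τ) := by
  have h1 := F.continuous_V τ
  have h2 := F.continuous_ρ τ
  have h3 := F.continuous_Vτ τ
  have h4 := F.continuous_Vθ τ
  have h5 := F.continuous_Qτ τ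
  have h6 := F.continuous_Qθ τ
  unfold J
  fun_prop

/-- Expansion of the energy density into its four nonnegative pieces. -/
theorem two_mul_energy_density (τ θ : ℝ) :
    2 * (exp (F.ρ τ θ - 2 * τ) * F.J τ θ)
      = exp (F.ρ τ θ - 2 * τ) * F.Vτ τ θ ^ 2 + exp (-F.ρ τ θ) * F.Vθ τ θ ^ 2
        + exp (F.ρ τ θ - 2 * τ + 2 * (F.V τ θ - τ)) * F.Qτ τ θ ^ 2
        + exp (-F.ρ τ θ + 2 * (F.V τ θ - τ)) * F.Qθ τ θ ^ 2 := by
  have h : exp (-F.ρ τ θ) = exp (F.ρ τ θ - 2 * τ) * exp (2 * (τ - F.ρ τ θ)) := by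
    rw [← exp_add]; ring_nf
  rw [exp_add, exp_add, h]
  unfold J
  ring

theorem integral_le_two_mul_E {τ : ℝ} {p : ℝ → ℝ} (hp : Continuous p)
    (hle : ∀ θ, p θ ≤ 2 * (exp (F.ρ τ θ - 2 * τ) * F.J τ θ)) :
    ∫ θ in (0:ℝ)..1, p θ ≤ 2 * F.E τ := by
  have h1 := F.continuous_ρ τ
  have h2 := F.continuous_J τ
  unfold E
  rw [← intervalIntegral.integral_const_mul]
  exact intervalIntegral.integral_mono_on zero_le_one (hp.intervalIntegrable _ _)
    (Continuous.intervalIntegrable (by fun_prop) _ _) fun θ _ => hle θ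

theorem Pi_nonneg (τ : ℝ) : 0 ≤ F.Pi τ :=
  intervalIntegral.integral_nonneg zero_le_one fun _ _ => (exp_pos _).le

theorem iInf_ρ_le {F : T2Flow} (hF : F.IsEinsteinFlow) {s₀ τ : ℝ} (h : s₀ ≤ τ) (θ : ℝ) :
    ⨅ x, F.ρ s₀ x ≤ F.ρ τ θ := by
  have hmono : Monotone fun s => F.ρ s θ := by
    refine monotone_of_deriv_nonneg
      ((contDiff_slice_left F.smooth_ρ θ).differentiable one_ne_zero) fun s => ?_
    have := hF.2.2.2.1 s θ
    unfold ρτ at this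
    rw [this]
    exact (exp_pos _).le
  have hbdd : BddBelow (Set.range (F.ρ s₀)) :=
    ((F.periodic_ρ s₀).isBounded_of_continuous one_ne_zero (F.continuous_ρ s₀)).bddBelow
  exact (ciInf_le hbdd θ).trans (hmono h)

theorem integral_abs_Vτ_le {τ r : ℝ} (hr : ∀ θ, r ≤ F.ρ τ θ) :
    ∫ θ in (0:ℝ)..1, |F.Vτ τ θ| ≤ √(2 * F.E τ) * exp (τ - r / 2) := by
  have h2 := F.continuous_ρ τ
  have h3 := F.continuous_Vτ τ
  have hs : exp (τ - r / 2) = √(exp (2 * τ - r)) := by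
    rw [eq_comm, Real.sqrt_eq_iff_mul_self_eq_of_pos (exp_pos _), ← exp_add]; ring_nf
  rw [hs]
  refine integral_abs_le_sqrt_mul_sqrt h3
    (p := fun θ => exp (F.ρ τ θ - 2 * τ) * F.Vτ τ θ ^ 2)
    (q := fun θ => exp (2 * τ - F.ρ τ θ)) (by fun_prop) (by fun_prop)
    (fun θ => by positivity) (fun θ => by positivity) (fun θ => ?_) ?_ ?_
  · have : exp (F.ρ τ θ - 2 * τ) * exp (2 * τ - F.ρ τ θ) = 1 := by
      rw [← exp_add]; simp
    linear_combination (-F.Vτ τ θ ^ 2) * this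
  · refine F.integral_le_two_mul_E (by fun_prop) fun θ => ?_
    rw [two_mul_energy_density, add_assoc, add_assoc]
    exact le_add_of_nonneg_right (by positivity)
  · refine (intervalIntegral.integral_mono_on zero_le_one
      (Continuous.intervalIntegrable (by fun_prop) _ _)
      (intervalIntegrable_const (c := exp (2 * τ - r))) fun θ _ => ?_).trans_eq (by simp)
    exact exp_le_exp.2 (by linarith [hr θ])

theorem integral_abs_Vθ_le (τ : ℝ) :
    ∫ θ in (0:ℝ)..1, |F.Vθ τ θ| ≤ √(2 * F.E τ) * √(F.Pi τ) := by
  have h2 := F.continuous_ρ τ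
  have h3 := F.continuous_Vθ τ
  refine integral_abs_le_sqrt_mul_sqrt h3
    (p := fun θ => exp (-F.ρ τ θ) * F.Vθ τ θ ^ 2)
    (q := fun θ => exp (F.ρ τ θ)) (by fun_prop) (by fun_prop)
    (fun θ => by positivity) (fun θ => by positivity) (fun θ => ?_) ?_ le_rfl
  · have : exp (-F.ρ τ θ) * exp (F.ρ τ θ) = 1 := by
      rw [← exp_add]; simp
    linear_combination (-F.Vθ τ θ ^ 2) * this
  · refine F.integral_le_two_mul_E (by fun_prop) fun θ => ?_
    rw [two_mul_energy_density, add_assoc, add_comm (exp _ * F.Vτ τ θ ^ 2), add_assoc]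
    exact le_add_of_nonneg_right (by positivity)

theorem integral_abs_Qθ_le {τ m : ℝ} (hm : ∀ θ, m ≤ F.V τ θ) :
    ∫ θ in (0:ℝ)..1, |F.Qθ τ θ| ≤ √(2 * F.E τ) * √(exp (2 * (τ - m)) * F.Pi τ) := by
  have h1 := F.continuous_V τ
  have h2 := F.continuous_ρ τ
  have h3 := F.continuous_Qθ τ
  refine integral_abs_le_sqrt_mul_sqrt h3
    (p := fun θ => exp (-F.ρ τ θ + 2 * (F.V τ θ - τ)) * F.Qθ τ θ ^ 2)
    (q := fun θ => exp (F.ρ τ θ - 2 * (F.V τ θ - τ))) (by fun_prop) (by fun_prop)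
    (fun θ => by positivity) (fun θ => by positivity) (fun θ => ?_) ?_ ?_
  · have : exp (-F.ρ τ θ + 2 * (F.V τ θ - τ)) * exp (F.ρ τ θ - 2 * (F.V τ θ - τ)) = 1 := by
      rw [← exp_add]; simp
    linear_combination (-F.Qθ τ θ ^ 2) * this
  · refine F.integral_le_two_mul_E (by fun_prop) fun θ => ?_
    rw [two_mul_energy_density]
    exact le_add_of_nonneg_left (by positivity)
  · unfold Pi
    rw [← intervalIntegral.integral_const_mul]
    refine intervalIntegral.integral_mono_on zero_le_one
      (Continuous.intervalIntegrable (by fun_prop) _ _)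
      (Continuous.intervalIntegrable (by fun_prop) _ _) fun θ _ => ?_
    rw [← exp_add]
    exact exp_le_exp.2 (by linarith [hm θ])

theorem integral_abs_twist_flux_le {τ M : ℝ} (hM : ∀ θ, F.V τ θ ≤ M) :
    ∫ θ in (0:ℝ)..1, |exp (F.ρ τ θ + 2 * (F.V τ θ - τ)) * F.Qτ τ θ|
      ≤ √(2 * F.E τ) * √(exp (2 * M) * F.Pi τ) := by
  have h1 := F.continuous_V τ
  have h2 := F.continuous_ρ τ
  have h3 := F.continuous_Qτ τ
  refine integral_abs_le_sqrt_mul_sqrt (by fun_prop)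
    (p := fun θ => exp (F.ρ τ θ - 2 * τ + 2 * (F.V τ θ - τ)) * F.Qτ τ θ ^ 2)
    (q := fun θ => exp (F.ρ τ θ + 2 * F.V τ θ)) (by fun_prop) (by fun_prop)
    (fun θ => by positivity) (fun θ => by positivity) (fun θ => le_of_eq ?_) ?_ ?_
  · have : exp (F.ρ τ θ + 2 * (F.V τ θ - τ)) ^ 2
        = exp (F.ρ τ θ - 2 * τ + 2 * (F.V τ θ - τ)) * exp (F.ρ τ θ + 2 * F.V τ θ) := by
      rw [← exp_add, sq, ← exp_add]; ring_nf
    linear_combination (F.Qτ τ θ ^ 2) * this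
  · refine F.integral_le_two_mul_E (by fun_prop) fun θ => ?_
    rw [two_mul_energy_density, add_right_comm]
    exact le_add_of_nonneg_left (by positivity)
  · unfold Pi
    rw [← intervalIntegral.integral_const_mul]
    refine intervalIntegral.integral_mono_on zero_le_one
      (Continuous.intervalIntegrable (by fun_prop) _ _)
      (Continuous.intervalIntegrable (by fun_prop) _ _) fun θ _ => ?_
    rw [← exp_add]
    exact exp_le_exp.2 (by linarith [hM θ])

theorem exists_bounds_V (τ : ℝ) :
    ∃ m M : ℝ, (∀ θ, m ≤ F.V τ θ) ∧ (∀ θ, F.V τ θ ≤ M) ∧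
      M - m ≤ ∫ θ in (0:ℝ)..1, |F.Vθ τ θ| := by
  have hc : ContinuousOn (F.V τ) (Set.Icc 0 1) := (F.continuous_V τ).continuousOn
  have hne : (Set.Icc (0:ℝ) 1).Nonempty := Set.nonempty_Icc.2 zero_le_one
  obtain ⟨a, ha, hmin⟩ := isCompact_Icc.exists_isMinOn hne hc
  obtain ⟨b, hb, hmax⟩ := isCompact_Icc.exists_isMaxOn hne hc
  have hper : ∀ θ, ∃ y ∈ Set.Icc (0:ℝ) 1, F.V τ θ = F.V τ y := fun θ => by
    obtain ⟨y, hy, h⟩ := (F.periodic_V τ).exists_mem_Ico₀ one_pos θ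
    exact ⟨y, Set.Ico_subset_Icc_self hy, h⟩
  refine ⟨F.V τ a, F.V τ b, fun θ => ?_, fun θ => ?_, ?_⟩
  · obtain ⟨y, hy, h⟩ := hper θ
    exact h ▸ hmin hy
  · obtain ⟨y, hy, h⟩ := hper θ
    exact h ▸ hmax hy
  · exact (le_abs_self _).trans (abs_sub_le_integral_abs_deriv (F.contDiff_V τ) ha hb)

/-- When `B = 0`, `∫ e^ρ V_τ` agrees with `A` up to `2 e^τ e^{2√(ΠE)} ΠE`. -/
theorem abs_integral_exp_mul_Vτ_le {τ : ℝ} (hB : F.B τ = 0) :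
    |∫ θ in (0:ℝ)..1, exp (F.ρ τ θ) * F.Vτ τ θ|
      ≤ |F.A τ| + 2 * (exp τ * exp (2 * √(F.Pi τ * F.E τ)) * (F.Pi τ * F.E τ)) := by
  have h1 := F.continuous_V τ
  have h2 := F.continuous_ρ τ
  have h3 := F.continuous_Qτ τ
  have h4 := F.continuous_Vτ τ
  have h5 := F.continuous_Q τ
  have hE : 0 ≤ 2 * F.E τ := by
    refine le_of_eq_of_le ?_ (F.integral_le_two_mul_E (p := fun _ => 0) continuous_const
      fun θ => ?_)
    · simp
    · rw [two_mul_energy_density]; positivity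
  have hPi := F.Pi_nonneg τ
  obtain ⟨m, M, hm, hM, hosc⟩ := F.exists_bounds_V τ
  have hsplit : ∫ θ in (0:ℝ)..1, exp (F.ρ τ θ) * F.Vτ τ θ
      = F.A τ + ∫ θ in (0:ℝ)..1,
          exp (F.ρ τ θ + 2 * (F.V τ θ - τ)) * F.Qτ τ θ * (F.Q τ θ - F.Q τ 0) := by
    have hA : F.A τ = F.A τ + F.Q τ 0 * F.B τ := by rw [hB]; ring
    rw [hA]
    unfold A B
    rw [← intervalIntegral.integral_const_mul, ← intervalIntegral.integral_add,
      ← intervalIntegral.integral_add]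
    · congr 1
      funext θ
      rw [exp_add]
      ring
    all_goals exact Continuous.intervalIntegrable (by fun_prop) _ _
  have htwist : |∫ θ in (0:ℝ)..1,
      exp (F.ρ τ θ + 2 * (F.V τ θ - τ)) * F.Qτ τ θ * (F.Q τ θ - F.Q τ 0)|
      ≤ (∫ θ in (0:ℝ)..1, |exp (F.ρ τ θ + 2 * (F.V τ θ - τ)) * F.Qτ τ θ|)
        * ∫ θ in (0:ℝ)..1, |F.Qθ τ θ| := by
    refine (intervalIntegral.abs_integral_le_integral_abs zero_le_one).trans ?_
    rw [← intervalIntegral.integral_mul_const]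
    refine intervalIntegral.integral_mono_on zero_le_one
      (Continuous.intervalIntegrable (by fun_prop) _ _)
      (Continuous.intervalIntegrable (by fun_prop) _ _) fun θ hθ => ?_
    rw [abs_mul]
    exact mul_le_mul_of_nonneg_left (abs_sub_le_integral_abs_deriv (F.contDiff_Q τ)
      (Set.left_mem_Icc.2 zero_le_one) hθ) (abs_nonneg _)
  have hprod : √(2 * F.E τ) * √(exp (2 * M) * F.Pi τ)
        * (√(2 * F.E τ) * √(exp (2 * (τ - m)) * F.Pi τ))
      = 2 * (exp τ * exp (M - m) * (F.Pi τ * F.E τ)) := by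
    have hexp : ∀ x : ℝ, √(exp (2 * x)) = exp x := fun x => by
      rw [Real.sqrt_eq_iff_mul_self_eq_of_pos (exp_pos _), ← exp_add]; ring_nf
    rw [Real.sqrt_mul (exp_pos _).le, Real.sqrt_mul (exp_pos _).le, hexp, hexp]
    have hx : exp M * exp (τ - m) = exp τ * exp (M - m) := by
      rw [← exp_add, ← exp_add]; ring_nf
    calc _ = (√(2 * F.E τ) * √(2 * F.E τ)) * (√(F.Pi τ) * √(F.Pi τ))
          * (exp M * exp (τ - m)) := by ring
      _ = _ := by rw [Real.mul_self_sqrt hE, Real.mul_self_sqrt hPi, hx]; ring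
  have hMm : M - m ≤ 2 * √(F.Pi τ * F.E τ) := by
    refine (hosc.trans (F.integral_abs_Vθ_le τ)).trans ?_
    rw [← Real.sqrt_mul hE]
    refine Real.sqrt_le_iff.2 ⟨by positivity, ?_⟩
    have hPE : 0 ≤ F.Pi τ * F.E τ := mul_nonneg hPi (by linarith)
    rw [mul_pow, Real.sq_sqrt hPE]
    linarith
  rw [hsplit]
  refine (abs_add_le _ _).trans (add_le_add le_rfl (htwist.trans ?_))
  calc _ ≤ √(2 * F.E τ) * √(exp (2 * M) * F.Pi τ)
        * (√(2 * F.E τ) * √(exp (2 * (τ - m)) * F.Pi τ)) :=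
        mul_le_mul (F.integral_abs_twist_flux_le hM) (F.integral_abs_Qθ_le hm)
          (intervalIntegral.integral_nonneg zero_le_one fun x _ => abs_nonneg _) (by positivity)
    _ = 2 * (exp τ * exp (M - m) * (F.Pi τ * F.E τ)) := hprod
    _ ≤ _ := by
      have hE' : 0 ≤ F.E τ := by linarith
      gcongr

end T2Flow

/-- For `B₀` solutions with initial data at `τ = s₀` and `ρ₀ := min_θ ρ(θ, s₀)`,
`|⟨V_τ⟩⟨(1/2)e^{ρ−2τ}V_τ⟩| ≲ e^{−ρ₀/2} e^{−τ} (|A| + e^{τ} e^{2(ΠE)^{1/2}} Π E) E^{1/2}`. -/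
theorem bad_v_bound :
    ∃ C : ℝ, 0 < C ∧ ∀ (F : T2Flow), F.IsEinsteinFlow → (∀ τ : ℝ, F.B τ = 0) →
      ∀ s₀ : ℝ, ∀ τ : ℝ, s₀ ≤ τ →
        |circleMean (fun θ => F.Vτ τ θ)
            * circleMean (fun θ => (1/2) * Real.exp (F.ρ τ θ - 2*τ) * F.Vτ τ θ)|
          ≤ C * (Real.exp (-(⨅ θ : ℝ, F.ρ s₀ θ) / 2) * Real.exp (-τ)
              * (|F.A τ| + Real.exp τ * Real.exp (2 * Real.sqrt (F.Pi τ * F.E τ))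
                  * (F.Pi τ * F.E τ))
              * Real.sqrt (F.E τ)) := by
  refine ⟨2, two_pos, fun F hF hB s₀ τ hτ => ?_⟩
  set r := ⨅ θ : ℝ, F.ρ s₀ θ
  have hVτ := F.integral_abs_Vτ_le fun θ => T2Flow.iInf_ρ_le hF hτ θ
  have hflux := F.abs_integral_exp_mul_Vτ_le (hB τ)
  set X := Real.exp τ * Real.exp (2 * √(F.Pi τ * F.E τ)) * (F.Pi τ * F.E τ)
  have hmean : circleMean (fun θ => (1/2) * Real.exp (F.ρ τ θ - 2*τ) * F.Vτ τ θ)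
      = (1/2) * Real.exp (-(2 * τ)) * ∫ θ in (0:ℝ)..1, Real.exp (F.ρ τ θ) * F.Vτ τ θ := by
    unfold circleMean
    rw [← intervalIntegral.integral_const_mul]
    congr 1
    funext θ
    simp only [sub_eq_add_neg, Real.exp_add]
    ring
  have habs : |circleMean (fun θ => F.Vτ τ θ)| ≤ √(2 * F.E τ) * Real.exp (τ - r / 2) :=
    (intervalIntegral.abs_integral_le_integral_abs zero_le_one).trans hVτ
  have hsqrt : √(2 * F.E τ) ≤ 2 * √(F.E τ) := by
    rw [Real.sqrt_mul zero_le_two]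
    gcongr
    exact Real.sqrt_le_iff.2 ⟨zero_le_two, by norm_num⟩
  have hA := abs_nonneg (F.A τ)
  have hexp : Real.exp (τ - r / 2) * Real.exp (-(2 * τ)) = Real.exp (-r / 2) * Real.exp (-τ) := by
    rw [← Real.exp_add, ← Real.exp_add]
    ring_nf
  have hflux' : |∫ θ in (0:ℝ)..1, Real.exp (F.ρ τ θ) * F.Vτ τ θ| ≤ 2 * (|F.A τ| + X) := by
    linarith
  rw [abs_mul, hmean, abs_mul, abs_of_pos (by positivity : 0 < (1/2) * Real.exp (-(2 * τ)))]
  calc _ ≤ (2 * √(F.E τ) * Real.exp (τ - r / 2))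
        * ((1/2) * Real.exp (-(2 * τ)) * (2 * (|F.A τ| + X))) := by
        refine mul_le_mul (habs.trans (by gcongr)) (by gcongr) (by positivity) (by positivity)
    _ = 2 * (Real.exp (τ - r / 2) * Real.exp (-(2 * τ)) * (|F.A τ| + X) * √(F.E τ)) := by ring
    _ = _ := by rw [hexp]
end
end

section
/- Along any B₀ T²-symmetric Einstein flow, at every time τ one has | e^{−2τ} ∫_{S¹} e^{2(V−τ)+ρ} (Q_τ² − e^{2(τ−ρ)} Q_θ²)(V − ⟨V⟩) dθ | ≲ Π^{1/2} E^{3/2}. -/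
noncomputable section

open Real MeasureTheory intervalIntegral

/-- The time derivative of a smooth function of `(τ, θ)` is continuous in `θ`. -/
theorem continuous_deriv_left {f : ℝ → ℝ → ℝ} (hf : ContDiff ℝ (⊤ : ℕ∞) (Function.uncurry f))
    (τ : ℝ) : Continuous fun θ => deriv (fun s => f s θ) τ := by
  have key : ∀ θ, deriv (fun s => f s θ) τ = fderiv ℝ (Function.uncurry f) (τ, θ) (1, 0) := by
    intro θ
    have h := (hf.differentiable (by simp) (τ, θ)).hasFDerivAt
    exact (h.comp_hasDerivAt (f := fun s => (s, θ)) τ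
      ((hasDerivAt_id τ).prodMk (hasDerivAt_const τ θ))).deriv
  simp_rw [key]
  have hslice : Continuous fun θ : ℝ => (τ, θ) := by fun_prop
  exact ((hf.continuous_fderiv (by simp)).comp hslice).clm_apply continuous_const

/-- A slice at fixed `τ` of a smooth function of `(τ, θ)` is smooth. -/
theorem contDiff_slice {f : ℝ → ℝ → ℝ} (hf : ContDiff ℝ (⊤ : ℕ∞) (Function.uncurry f))
    (τ : ℝ) : ContDiff ℝ (⊤ : ℕ∞) (f τ) :=
  hf.comp (contDiff_const.prodMk contDiff_id)

/-- The oscillation of a `C¹` function about its mean is at most its total variation. -/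
theorem abs_sub_circleMean_le {v : ℝ → ℝ} (hv : ContDiff ℝ 1 v) {x : ℝ}
    (hx : x ∈ Set.Icc (0 : ℝ) 1) :
    |v x - circleMean v| ≤ ∫ y in (0 : ℝ)..1, |deriv v y| := by
  have hd : Continuous (deriv v) := hv.continuous_deriv le_rfl
  have hosc : ∀ y ∈ Set.Icc (0 : ℝ) 1, |v x - v y| ≤ ∫ z in (0 : ℝ)..1, |deriv v z| := by
    intro y hy
    rw [← integral_deriv_eq_sub (fun z _ => hv.differentiable (by simp) z)
      (hd.intervalIntegrable y x), ← Real.norm_eq_abs]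
    refine norm_integral_le_integral_norm_uIoc.trans ?_
    rw [integral_of_le zero_le_one]
    refine setIntegral_mono_set (hd.abs.integrableOn_Ioc) (ae_of_all _ fun _ => abs_nonneg _) ?_
    refine Filter.Eventually.of_forall (Set.Ioc_subset_Ioc ?_ ?_)
    · exact le_min hy.1 hx.1
    · exact max_le hy.2 hx.2
  have hmean : v x - circleMean v = ∫ y in (0 : ℝ)..1, (v x - v y) := by
    rw [integral_sub (by simp) (hv.continuous.intervalIntegrable 0 1)]
    simp [circleMean]
  rw [hmean]
  refine (abs_integral_le_integral_abs zero_le_one).trans ?_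
  have hc : Continuous fun y => |v x - v y| := (continuous_const.sub hv.continuous).abs
  refine (integral_mono_on zero_le_one (hc.intervalIntegrable 0 1)
    (g := fun _ => ∫ z in (0 : ℝ)..1, |deriv v z|) (by simp) hosc).trans ?_
  simp

/-- Weighted Cauchy–Schwarz inequality with weight `exp r`. -/
theorem sq_integral_abs_le_weighted {r g : ℝ → ℝ} (hr : Continuous r) (hg : Continuous g) :
    (∫ x in (0 : ℝ)..1, |g x|) ^ 2
      ≤ (∫ x in (0 : ℝ)..1, exp (r x)) * ∫ x in (0 : ℝ)..1, exp (-r x) * g x ^ 2 := by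
  have hquad : ∀ t : ℝ, 0 ≤ (∫ x in (0 : ℝ)..1, exp (r x)) * (t * t)
      + (-2 * ∫ x in (0 : ℝ)..1, |g x|) * t + ∫ x in (0 : ℝ)..1, exp (-r x) * g x ^ 2 := by
    intro t
    have h : 0 ≤ ∫ x in (0 : ℝ)..1,
        (exp (r x) * (t * t) + (-2 * |g x|) * t + exp (-r x) * g x ^ 2) := by
      refine integral_nonneg zero_le_one fun x _ => ?_
      have he : exp (r x) * exp (-r x) = 1 := by rw [← exp_add]; simp
      have hsq : exp (r x) * (t * t) + (-2 * |g x|) * t + exp (-r x) * g x ^ 2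
          = exp (r x) * (t - exp (-r x) * |g x|) ^ 2 := by
        rw [← sq_abs (g x)]
        linear_combination (2 * t * |g x| - exp (-r x) * |g x| ^ 2) * he
      rw [hsq]
      positivity
    have i₁ : IntervalIntegrable (fun x => exp (r x) * (t * t)) volume 0 1 :=
      Continuous.intervalIntegrable (by fun_prop) 0 1
    have i₂ : IntervalIntegrable (fun x => (-2 * |g x|) * t) volume 0 1 :=
      Continuous.intervalIntegrable (by fun_prop) 0 1
    have i₃ : IntervalIntegrable (fun x => exp (-r x) * g x ^ 2) volume 0 1 :=
      Continuous.intervalIntegrable (by fun_prop) 0 1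
    rw [integral_add (i₁.add i₂) i₃, integral_add i₁ i₂] at h
    simpa only [intervalIntegral.integral_mul_const, intervalIntegral.integral_const_mul] using h
  have h := discrim_le_zero hquad
  unfold discrim at h
  linarith

namespace T2Flow

variable (F : T2Flow) (τ : ℝ)

theorem continuous_energyDensity : Continuous fun θ => exp (F.ρ τ θ - 2*τ) * F.J τ θ := by
  have hV := (contDiff_slice F.smooth_V τ).continuous
  have hρ := (contDiff_slice F.smooth_ρ τ).continuous
  have hVt : Continuous (F.Vτ τ) := continuous_deriv_left F.smooth_V τ
  have hQt : Continuous (F.Qτ τ) := continuous_deriv_left F.smooth_Q τ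
  have hVx : Continuous (F.Vθ τ) := (contDiff_slice F.smooth_V τ).continuous_deriv (by simp)
  have hQx : Continuous (F.Qθ τ) := (contDiff_slice F.smooth_Q τ).continuous_deriv (by simp)
  unfold J
  fun_prop

theorem integral_exp_neg_mul_Vθ_sq_le :
    ∫ θ in (0:ℝ)..1, exp (-F.ρ τ θ) * F.Vθ τ θ ^ 2 ≤ 2 * F.E τ := by
  have hρ := (contDiff_slice F.smooth_ρ τ).continuous
  have hVx : Continuous (F.Vθ τ) := (contDiff_slice F.smooth_V τ).continuous_deriv (by simp)
  rw [E, ← intervalIntegral.integral_const_mul]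
  refine integral_mono_on zero_le_one (Continuous.intervalIntegrable (by fun_prop) 0 1)
    ((F.continuous_energyDensity τ).const_mul 2 |>.intervalIntegrable 0 1) fun θ _ => ?_
  have he : exp (-F.ρ τ θ) = exp (F.ρ τ θ - 2*τ) * exp (2*(τ - F.ρ τ θ)) := by
    rw [← exp_add]; ring_nf
  have hrest : 0 ≤ exp (F.ρ τ θ - 2*τ) * (F.Vτ τ θ ^ 2
      + exp (2*(F.V τ θ - τ)) * (F.Qτ τ θ ^ 2 + exp (2*(τ - F.ρ τ θ)) * F.Qθ τ θ ^ 2)) := by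
    positivity
  rw [he, J]
  linarith

theorem abs_V_sub_circleMean_le {θ : ℝ} (hθ : θ ∈ Set.Icc (0 : ℝ) 1) :
    |F.V τ θ - circleMean (F.V τ)| ≤ √(F.Pi τ * (2 * F.E τ)) := by
  have hV := contDiff_slice F.smooth_V τ
  refine (abs_sub_circleMean_le (hV.of_le (by simp)) hθ).trans (Real.le_sqrt_of_sq_le ?_)
  refine (sq_integral_abs_le_weighted (contDiff_slice F.smooth_ρ τ).continuous
    (hV.continuous_deriv (by simp))).trans ?_
  exact mul_le_mul_of_nonneg_left (F.integral_exp_neg_mul_Vθ_sq_le τ)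
    (integral_nonneg zero_le_one fun _ _ => (exp_pos _).le)

theorem abs_Q_terms_le (θ : ℝ) :
    exp (-2*τ) * |exp (2*(F.V τ θ - τ) + F.ρ τ θ)
        * (F.Qτ τ θ ^ 2 - exp (2*(τ - F.ρ τ θ)) * F.Qθ τ θ ^ 2)|
      ≤ 2 * (exp (F.ρ τ θ - 2*τ) * F.J τ θ) := by
  have he : exp (-2*τ) * exp (2*(F.V τ θ - τ) + F.ρ τ θ)
      = exp (F.ρ τ θ - 2*τ) * exp (2*(F.V τ θ - τ)) := by
    rw [← exp_add, ← exp_add]; ring_nf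
  have habs : |F.Qτ τ θ ^ 2 - exp (2*(τ - F.ρ τ θ)) * F.Qθ τ θ ^ 2|
      ≤ F.Qτ τ θ ^ 2 + exp (2*(τ - F.ρ τ θ)) * F.Qθ τ θ ^ 2 := by
    refine (abs_sub _ _).trans_eq ?_
    rw [abs_of_nonneg (by positivity), abs_of_nonneg (by positivity)]
  have hmul := mul_le_mul_of_nonneg_left habs
    (by positivity : 0 ≤ exp (F.ρ τ θ - 2*τ) * exp (2*(F.V τ θ - τ)))
  have hrest : 0 ≤ exp (F.ρ τ θ - 2*τ) * (F.Vτ τ θ ^ 2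
      + exp (2*(τ - F.ρ τ θ)) * F.Vθ τ θ ^ 2) := by
    positivity
  rw [abs_mul, abs_of_pos (exp_pos _), ← mul_assoc, he, J]
  linarith

end T2Flow

/-- For `B₀` solutions,
`|e^{−2τ} ∫ e^{2(V−τ)+ρ} (Q_τ² − e^{2(τ−ρ)}Q_θ²)(V − ⟨V⟩) dθ| ≲ Π^{1/2} E^{3/2}`. -/
theorem strange_bound :
    ∃ C : ℝ, 0 < C ∧ ∀ (F : T2Flow), F.IsEinsteinFlow → (∀ τ : ℝ, F.B τ = 0) →
      ∀ τ : ℝ,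
        |Real.exp (-2*τ) * ∫ θ in (0:ℝ)..1,
            Real.exp (2*(F.V τ θ - τ) + F.ρ τ θ)
              * (F.Qτ τ θ ^ 2 - Real.exp (2*(τ - F.ρ τ θ)) * F.Qθ τ θ ^ 2)
              * (F.V τ θ - circleMean (F.V τ))|
          ≤ C * (Real.sqrt (F.Pi τ) * (F.E τ * Real.sqrt (F.E τ))) := by
  refine ⟨2 * √2, by positivity, fun F _ _ τ => ?_⟩
  have hPi : 0 ≤ F.Pi τ := integral_nonneg zero_le_one fun _ _ => (exp_pos _).le
  have hconst : ∫ θ in (0:ℝ)..1, 2 * (exp (F.ρ τ θ - 2*τ) * F.J τ θ) * √(F.Pi τ * (2 * F.E τ))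
      = 2 * √2 * (√(F.Pi τ) * (F.E τ * √(F.E τ))) := by
    rw [intervalIntegral.integral_mul_const, intervalIntegral.integral_const_mul, ← T2Flow.E,
      Real.sqrt_mul hPi, Real.sqrt_mul zero_le_two]
    ring
  rw [← intervalIntegral.integral_const_mul, ← hconst, ← Real.norm_eq_abs]
  refine norm_integral_le_of_norm_le zero_le_one (ae_of_all _ fun θ hθ => ?_)
    (((F.continuous_energyDensity τ).const_mul 2).mul_const _ |>.intervalIntegrable 0 1)
  rw [Real.norm_eq_abs, abs_mul, abs_mul _ (F.V τ θ - _), abs_of_pos (exp_pos _), ← mul_assoc]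
  exact mul_le_mul (F.abs_Q_terms_le τ θ)
    (F.abs_V_sub_circleMean_le τ (Set.Ioc_subset_Icc_self hθ)) (abs_nonneg _)
    ((mul_nonneg (exp_pos _).le (abs_nonneg _)).trans (F.abs_Q_terms_le τ θ))
end
end

section
/- Along any T²-symmetric Einstein flow, the quantities Π and Y satisfy Π_τ = e^{−2τ} Y and Y_τ = e^{2τ} E Y Π^{−1} + Ω, where the error term Ω satisfies |Ω| ≤ e^{4τ} E ⟨e^{l+ρ−τ} J⟩ = e^{τ} E Y_τ. -/
noncomputable section

open Real MeasureTheory intervalIntegral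

open Function Set in
/-- Differentiation under an interval integral of a jointly continuous function with jointly
continuous partial derivative. -/
theorem hasDerivAt_integral_of_continuous_deriv {f f' : ℝ → ℝ → ℝ}
    (hf : Continuous (uncurry f)) (hf' : Continuous (uncurry f'))
    (h : ∀ s x, HasDerivAt (fun s => f s x) (f' s x) s) (a b τ : ℝ) :
    HasDerivAt (fun s => ∫ x in a..b, f s x) (∫ x in a..b, f' τ x) τ := by
  obtain ⟨C, hC⟩ := ((isCompact_Icc (a := τ - 1) (b := τ + 1)).prod
    (isCompact_uIcc (a := a) (b := b))).exists_bound_of_continuousOn hf'.continuousOn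
  have hslice : ∀ s, Continuous (f s) := fun s => hf.comp (Continuous.prodMk_right s)
  have hslice' : Continuous (f' τ) := hf'.comp (Continuous.prodMk_right τ)
  refine (intervalIntegral.hasDerivAt_integral_of_dominated_loc_of_deriv_le
    (bound := fun _ => C) (Icc_mem_nhds (by linarith) (by linarith) : Icc (τ - 1) (τ + 1) ∈ _)
    (.of_forall fun s => (hslice s).aestronglyMeasurable) ((hslice τ).intervalIntegrable a b)
    hslice'.aestronglyMeasurable (.of_forall fun x hx s hs => ?_)
    intervalIntegrable_const (.of_forall fun x _ s _ => h s x)).2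
  exact hC (s, x) ⟨hs, uIoc_subset_uIcc hx⟩

open Function in
theorem ContDiff.hasDerivAt_fst {f : ℝ → ℝ → ℝ} (hf : ContDiff ℝ (⊤ : ℕ∞) (uncurry f))
    (s x : ℝ) : HasDerivAt (fun s => f s x) (fderiv ℝ (uncurry f) (s, x) (1, 0)) s :=
  HasFDerivAt.comp_hasDerivAt (f := fun s => (s, x)) s
    ((hf.differentiable (by simp)) (s, x)).hasFDerivAt
    ((hasDerivAt_id s).prodMk (hasDerivAt_const s x))

open Function in
theorem ContDiff.hasDerivAt_snd {f : ℝ → ℝ → ℝ} (hf : ContDiff ℝ (⊤ : ℕ∞) (uncurry f))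
    (s x : ℝ) : HasDerivAt (fun x => f s x) (fderiv ℝ (uncurry f) (s, x) (0, 1)) x :=
  HasFDerivAt.comp_hasDerivAt (f := fun x => (s, x)) x
    ((hf.differentiable (by simp)) (s, x)).hasFDerivAt
    ((hasDerivAt_const x s).prodMk (hasDerivAt_id x))

open Function in
theorem ContDiff.continuous_deriv_fst {f : ℝ → ℝ → ℝ}
    (hf : ContDiff ℝ (⊤ : ℕ∞) (uncurry f)) :
    Continuous (fun p : ℝ × ℝ => deriv (fun s => f s p.2) p.1) := by
  simp_rw [fun p : ℝ × ℝ => (hf.hasDerivAt_fst p.1 p.2).deriv]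
  exact (hf.continuous_fderiv (by simp)).clm_apply continuous_const

open Function in
theorem ContDiff.continuous_deriv_snd {f : ℝ → ℝ → ℝ}
    (hf : ContDiff ℝ (⊤ : ℕ∞) (uncurry f)) :
    Continuous (fun p : ℝ × ℝ => deriv (fun x => f p.1 x) p.2) := by
  simp_rw [fun p : ℝ × ℝ => (hf.hasDerivAt_snd p.1 p.2).deriv]
  exact (hf.continuous_fderiv (by simp)).clm_apply continuous_const

theorem abs_integral_mul_le_mul_integral {a b C : ℝ} {v w : ℝ → ℝ} (hab : a ≤ b)
    (hw : Continuous w) (hw0 : ∀ x, 0 ≤ w x)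
    (hv : ∀ x ∈ Set.Icc a b, |v x| ≤ C) :
    |∫ x in a..b, v x * w x| ≤ C * ∫ x in a..b, w x := by
  rw [← intervalIntegral.integral_const_mul, ← Real.norm_eq_abs]
  refine intervalIntegral.norm_integral_le_of_norm_le hab (.of_forall fun x hx => ?_)
    ((hw.const_mul C).intervalIntegrable a b)
  rw [norm_mul, Real.norm_eq_abs, Real.norm_of_nonneg (hw0 x)]
  exact mul_le_mul_of_nonneg_right (hv x (Set.Ioc_subset_Icc_self hx)) (hw0 x)

/-- A function of oscillation at most `C` correlates with a nonnegative density `g` as its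
`w`-weighted average does, up to `C * ∫ g`. -/
theorem abs_integral_mul_sub_weighted_average_le {a b C : ℝ} {u g w : ℝ → ℝ} (hab : a ≤ b)
    (hu : Continuous u) (hg : Continuous g) (hw : Continuous w)
    (hg0 : ∀ x, 0 ≤ g x) (hw0 : ∀ x, 0 ≤ w x) (hW : 0 < ∫ x in a..b, w x)
    (hosc : ∀ x ∈ Set.Icc a b, ∀ y ∈ Set.Icc a b, |u x - u y| ≤ C) :
    |(∫ x in a..b, u x * g x)
        - (∫ x in a..b, g x) * (∫ x in a..b, u x * w x) / ∫ x in a..b, w x|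
      ≤ C * ∫ x in a..b, g x := by
  set W := ∫ x in a..b, w x with hWdef
  set m := (∫ x in a..b, u x * w x) / W with hm
  have split : ∀ (c : ℝ) (k : ℝ → ℝ), Continuous k →
      ∫ x in a..b, (u x - c) * k x = (∫ x in a..b, u x * k x) - c * ∫ x in a..b, k x := by
    intro c k hk
    simp_rw [sub_mul]
    have huk : Continuous fun x => u x * k x := hu.mul hk
    rw [intervalIntegral.integral_sub (huk.intervalIntegrable a b)
      ((hk.const_mul c).intervalIntegrable a b), intervalIntegral.integral_const_mul]
  have hdev : ∀ x ∈ Set.Icc a b, |u x - m| ≤ C := by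
    intro x hx
    have h := abs_integral_mul_le_mul_integral hab hw hw0 (fun y hy => hosc y hy x hx)
    rw [split _ w hw, ← hWdef] at h
    have hmx : (∫ y in a..b, u y * w y) - u x * W = (m - u x) * W := by
      rw [hm]; field_simp
    rw [hmx, abs_mul, abs_of_pos hW, abs_sub_comm] at h
    exact le_of_mul_le_mul_right h hW
  have h := abs_integral_mul_le_mul_integral hab hg hg0 hdev
  rw [split _ g hg] at h
  rwa [mul_div_assoc, mul_comm (∫ x in a..b, g x)]

theorem abs_sub_le_integral_of_abs_deriv_le {a b : ℝ} {u u' k : ℝ → ℝ}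
    (hu : ∀ x, HasDerivAt u (u' x) x) (hu' : Continuous u') (hk : Continuous k)
    (h : ∀ x, |u' x| ≤ k x) {x y : ℝ} (hx : x ∈ Set.Icc a b) (hy : y ∈ Set.Icc a b) :
    |u x - u y| ≤ ∫ z in a..b, k z := by
  wlog hxy : y ≤ x generalizing x y
  · rw [abs_sub_comm]
    exact this hy hx (le_of_not_ge hxy)
  rw [← intervalIntegral.integral_eq_sub_of_hasDerivAt (fun z _ => hu z)
    (hu'.intervalIntegrable y x), ← Real.norm_eq_abs]
  exact (intervalIntegral.norm_integral_le_of_norm_le hxy (.of_forall fun z _ => h z)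
    (hk.intervalIntegrable y x)).trans
    (intervalIntegral.integral_mono_interval hy.1 hxy hx.2
      (.of_forall fun z => (abs_nonneg _).trans (h z)) (hk.intervalIntegrable a b))

namespace T2Flow

theorem continuous_J_s14 (F : T2Flow) : Continuous (Function.uncurry F.J) := by
  have h₁ : Continuous (fun p : ℝ × ℝ => F.Vτ p.1 p.2) := F.smooth_V.continuous_deriv_fst
  have h₂ : Continuous (fun p : ℝ × ℝ => F.Vθ p.1 p.2) := F.smooth_V.continuous_deriv_snd
  have h₃ : Continuous (fun p : ℝ × ℝ => F.Qτ p.1 p.2) := F.smooth_Q.continuous_deriv_fst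
  have h₄ : Continuous (fun p : ℝ × ℝ => F.Qθ p.1 p.2) := F.smooth_Q.continuous_deriv_snd
  have h₅ : Continuous (fun p : ℝ × ℝ => F.ρ p.1 p.2) := F.smooth_ρ.continuous
  have h₆ : Continuous (fun p : ℝ × ℝ => F.V p.1 p.2) := F.smooth_V.continuous
  unfold J Function.uncurry
  fun_prop

theorem J_nonneg (F : T2Flow) (τ θ : ℝ) : 0 ≤ F.J τ θ := by
  unfold J
  positivity

theorem hasDerivAt_ρ_fst (F : T2Flow) (τ θ : ℝ) :
    HasDerivAt (fun s => F.ρ s θ) (F.ρτ τ θ) τ :=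
  (F.smooth_ρ.hasDerivAt_fst τ θ).differentiableAt.hasDerivAt

theorem hasDerivAt_l_fst (F : T2Flow) (τ θ : ℝ) :
    HasDerivAt (fun s => F.l s θ) (F.lτ τ θ) τ :=
  (F.smooth_l.hasDerivAt_fst τ θ).differentiableAt.hasDerivAt

theorem hasDerivAt_l_snd (F : T2Flow) (τ θ : ℝ) :
    HasDerivAt (fun x => F.l τ x) (F.lθ τ θ) θ :=
  (F.smooth_l.hasDerivAt_snd τ θ).differentiableAt.hasDerivAt

theorem Pi_pos (F : T2Flow) (τ : ℝ) : 0 < F.Pi τ := by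
  have hρ : Continuous (F.ρ τ) := F.smooth_ρ.continuous.comp (Continuous.prodMk_right τ)
  exact intervalIntegral.intervalIntegral_pos_of_pos
    ((Real.continuous_exp.comp hρ).intervalIntegrable 0 1) (fun _ => exp_pos _) one_pos

namespace IsEinsteinFlow

variable {F : T2Flow}

theorem deriv_Pi (hF : F.IsEinsteinFlow) (τ : ℝ) :
    deriv F.Pi τ = exp (-2 * τ) * F.Y τ := by
  obtain ⟨-, -, -, hρ, -⟩ := hF
  have hcρ : Continuous (fun p : ℝ × ℝ => F.ρ p.1 p.2) := F.smooth_ρ.continuous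
  have hcl : Continuous (fun p : ℝ × ℝ => F.l p.1 p.2) := F.smooth_l.continuous
  have h := hasDerivAt_integral_of_continuous_deriv
    (f := fun s x => exp (F.ρ s x)) (f' := fun s x => exp (F.ρ s x) * exp (F.l s x))
    (by unfold Function.uncurry; fun_prop) (by unfold Function.uncurry; fun_prop)
    (fun s x => by rw [← hρ s x]; exact (F.hasDerivAt_ρ_fst s x).exp) 0 1 τ
  refine h.deriv.trans ?_
  rw [Y, ← intervalIntegral.integral_const_mul]
  simp_rw [← exp_add]
  congr! 3
  ring

theorem deriv_Y (hF : F.IsEinsteinFlow) (τ : ℝ) :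
    deriv F.Y τ = ∫ θ in (0:ℝ)..1, exp (F.l τ θ + F.ρ τ θ + 2 * τ) * F.J τ θ := by
  obtain ⟨-, -, hJ, -, -⟩ := hF
  have hcρ : Continuous (fun p : ℝ × ℝ => F.ρ p.1 p.2) := F.smooth_ρ.continuous
  have hcl : Continuous (fun p : ℝ × ℝ => F.l p.1 p.2) := F.smooth_l.continuous
  have hcJ : Continuous (fun p : ℝ × ℝ => F.J p.1 p.2) := F.continuous_J_s14
  refine (hasDerivAt_integral_of_continuous_deriv
    (f := fun s x => exp (F.l s x + F.ρ s x + 2 * s))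
    (f' := fun s x => exp (F.l s x + F.ρ s x + 2 * s) * F.J s x)
    (by unfold Function.uncurry; fun_prop) (by unfold Function.uncurry; fun_prop)
    (fun s x => ?_) 0 1 τ).deriv
  rw [← hJ s x]
  convert (((F.hasDerivAt_l_fst s x).add (F.hasDerivAt_ρ_fst s x)).add
    ((hasDerivAt_id s).const_mul 2)).exp using 2 <;> simp

/-- The momentum constraint controls `l_θ` by the energy density. -/
theorem abs_lθ_le (hF : F.IsEinsteinFlow) (τ θ : ℝ) :
    |F.lθ τ θ| ≤ exp (F.ρ τ θ - τ) * F.J τ θ := by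
  obtain ⟨-, -, -, -, hl⟩ := hF
  rw [hl, J]
  have h₁ : exp (2 * (τ - F.ρ τ θ)) = exp (τ - F.ρ τ θ) ^ 2 := by
    rw [← exp_nat_mul]; norm_num
  have h₂ : exp (F.ρ τ θ - τ) * exp (τ - F.ρ τ θ) = 1 := by
    rw [← exp_add]; simp
  rw [h₁]
  set c := exp (F.ρ τ θ - τ)
  set d := exp (τ - F.ρ τ θ)
  set q := exp (2 * (F.V τ θ - τ))
  have hc : 0 < c := exp_pos _
  have hq : 0 < q := exp_pos _
  have key : ∀ ε : ℝ, ε ^ 2 = 1 → ε * (F.Vθ τ θ * F.Vτ τ θ + q * F.Qθ τ θ * F.Qτ τ θ)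
      ≤ c * (1 / 2 * (F.Vτ τ θ ^ 2 + d ^ 2 * F.Vθ τ θ ^ 2
        + q * (F.Qτ τ θ ^ 2 + d ^ 2 * F.Qθ τ θ ^ 2))) := by
    intro ε hε
    have hsq : 0 ≤ c / 2 * ((F.Vτ τ θ - ε * (d * F.Vθ τ θ)) ^ 2
        + q * (F.Qτ τ θ - ε * (d * F.Qθ τ θ)) ^ 2) := by positivity
    linear_combination hsq + (c / 2 * d ^ 2 * (F.Vθ τ θ ^ 2 + q * F.Qθ τ θ ^ 2)) * hε
      - (ε * (F.Vθ τ θ * F.Vτ τ θ + q * F.Qθ τ θ * F.Qτ τ θ)) * h₂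
  refine abs_le.2 ⟨?_, ?_⟩
  · linarith [key (-1) (by norm_num)]
  · linarith [key 1 (by norm_num)]

/-- The oscillation of `e^l` over the circle is controlled by the energy density. -/
theorem abs_exp_l_sub_le (hF : F.IsEinsteinFlow) (τ : ℝ) {x y : ℝ}
    (hx : x ∈ Set.Icc (0:ℝ) 1) (hy : y ∈ Set.Icc (0:ℝ) 1) :
    |exp (F.l τ x) - exp (F.l τ y)|
      ≤ circleMean fun θ => exp (F.l τ θ + F.ρ τ θ - τ) * F.J τ θ := by
  have hcρ : Continuous (F.ρ τ) := F.smooth_ρ.continuous.comp (Continuous.prodMk_right τ)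
  have hcl : Continuous (F.l τ) := F.smooth_l.continuous.comp (Continuous.prodMk_right τ)
  have hcJ : Continuous (F.J τ) := F.continuous_J_s14.comp (Continuous.prodMk_right τ)
  have hclθ : Continuous (F.lθ τ) :=
    F.smooth_l.continuous_deriv_snd.comp (Continuous.prodMk_right τ)
  refine abs_sub_le_integral_of_abs_deriv_le (fun z => (F.hasDerivAt_l_snd τ z).exp)
    (by fun_prop) (by fun_prop) (fun z => ?_) hx hy
  rw [abs_mul, abs_exp, add_sub_assoc, exp_add, mul_assoc]
  exact mul_le_mul_of_nonneg_left (hF.abs_lθ_le τ z) (exp_pos _).le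

theorem abs_Ω_le (hF : F.IsEinsteinFlow) (τ : ℝ) :
    |F.Ω τ| ≤ exp (4 * τ) * F.E τ
      * circleMean fun θ => exp (F.l τ θ + F.ρ τ θ - τ) * F.J τ θ := by
  have hcρ : Continuous (F.ρ τ) := F.smooth_ρ.continuous.comp (Continuous.prodMk_right τ)
  have hcl : Continuous (F.l τ) := F.smooth_l.continuous.comp (Continuous.prodMk_right τ)
  have hcJ : Continuous (F.J τ) := F.continuous_J_s14.comp (Continuous.prodMk_right τ)
  have h := abs_integral_mul_sub_weighted_average_le (u := fun θ => exp (F.l τ θ))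
    (g := fun θ => exp (F.ρ τ θ) * F.J τ θ) (w := fun θ => exp (F.ρ τ θ)) zero_le_one
    (by fun_prop) (by fun_prop) (by fun_prop)
    (fun θ => mul_nonneg (exp_pos _).le (F.J_nonneg τ θ)) (fun θ => (exp_pos _).le)
    (F.Pi_pos τ) (fun x hx y hy => hF.abs_exp_l_sub_le τ hx hy)
  have hE : F.E τ = exp (-(2 * τ)) * ∫ θ in (0:ℝ)..1, exp (F.ρ τ θ) * F.J τ θ := by
    rw [E, ← intervalIntegral.integral_const_mul]
    simp_rw [sub_eq_neg_add, exp_add, mul_assoc]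
  have hY : F.Y τ = exp (2 * τ) * ∫ θ in (0:ℝ)..1, exp (F.l τ θ) * exp (F.ρ τ θ) := by
    rw [Y, ← intervalIntegral.integral_const_mul]
    simp_rw [exp_add, mul_comm (exp (2 * τ))]
  have hJ : ∫ θ in (0:ℝ)..1, exp (F.l τ θ + F.ρ τ θ + 2 * τ) * F.J τ θ
      = exp (2 * τ) * ∫ θ in (0:ℝ)..1, exp (F.l τ θ) * (exp (F.ρ τ θ) * F.J τ θ) := by
    rw [← intervalIntegral.integral_const_mul]
    congr! 2 with θ
    rw [exp_add, exp_add]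
    ring
  have h4 : exp (4 * τ) = exp (2 * τ) * exp (2 * τ) := by
    rw [← exp_add]; ring_nf
  have hinv : exp (2 * τ) * exp (-(2 * τ)) = 1 := by
    rw [← exp_add]; simp
  have hΩ : F.Ω τ = exp (2 * τ) * ((∫ θ in (0:ℝ)..1, exp (F.l τ θ) * (exp (F.ρ τ θ) * F.J τ θ))
      - (∫ θ in (0:ℝ)..1, exp (F.ρ τ θ) * F.J τ θ)
        * (∫ θ in (0:ℝ)..1, exp (F.l τ θ) * exp (F.ρ τ θ)) / F.Pi τ) := by
    rw [Ω, hJ, hE, hY, ← mul_assoc (exp (2 * τ)) (exp (-(2 * τ))), hinv]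
    ring
  rw [hΩ, abs_mul, abs_exp]
  refine (mul_le_mul_of_nonneg_left h (exp_pos _).le).trans_eq ?_
  rw [hE, h4]
  linear_combination (-exp (2 * τ) * (∫ θ in (0:ℝ)..1, exp (F.ρ τ θ) * F.J τ θ)
    * circleMean fun θ => exp (F.l τ θ + F.ρ τ θ - τ) * F.J τ θ) * hinv

end IsEinsteinFlow

end T2Flow

/-- The system `Π_τ = e^{−2τ} Y`, `Y_τ = e^{2τ} E Y Π⁻¹ + Ω`, with
`|Ω| ≤ e^{4τ} E ⟨e^{l+ρ−τ} J⟩ = e^{τ} E Y_τ`. -/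
theorem pi_y_system (F : T2Flow) (hF : F.IsEinsteinFlow) (τ : ℝ) :
    deriv F.Pi τ = Real.exp (-2*τ) * F.Y τ ∧
    deriv F.Y τ = Real.exp (2*τ) * F.E τ * F.Y τ / F.Pi τ + F.Ω τ ∧
    |F.Ω τ| ≤ Real.exp (4*τ) * F.E τ
        * circleMean (fun θ => Real.exp (F.l τ θ + F.ρ τ θ - τ) * F.J τ θ) ∧
    Real.exp (4*τ) * F.E τ
        * circleMean (fun θ => Real.exp (F.l τ θ + F.ρ τ θ - τ) * F.J τ θ)
      = Real.exp τ * F.E τ * deriv F.Y τ := by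
  refine ⟨hF.deriv_Pi τ, ?_, hF.abs_Ω_le τ, ?_⟩
  · rw [hF.deriv_Y, T2Flow.Ω]
    ring
  · have h : deriv F.Y τ = exp (3 * τ)
        * circleMean fun θ => exp (F.l τ θ + F.ρ τ θ - τ) * F.J τ θ := by
      rw [hF.deriv_Y, circleMean, ← intervalIntegral.integral_const_mul]
      congr! 2 with θ
      rw [← mul_assoc, ← exp_add]
      ring_nf
    have h4 : exp (4 * τ) = exp τ * exp (3 * τ) := by
      rw [← exp_add]; ring_nf
    rw [h, h4]
    ring
end
end
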